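/- arXiv:1601.00698 — 2 statements merged into one kernel-verified Lean document; each statement's English description precedes it below -/
import Mathlib

section
/- Finito operator strong quasi-monotonicity (Proposition C.2, Part 2): let f_1, …, f_N : H₀ → ℝ be differentiable and μ̂-strongly convex with 0 < μ̂ ≤ L, suppose each gradient ∇f_i is L-Lipschitz continuous, let 0 < γ ≤ 2/L, and define S : H → H by S(x) := x − P_D(x_1 − γ∇f_1(x_1), …, x_N − γ∇f_N(x_N)). Then with μ := 1 − √(1 − 2γμ̂ + γ²μ̂L), one has ⟨S(x) − S(y), x − y⟩ ≥ μ‖x − y‖² for all x, y ∈ H. -/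
local notation "⟪" x ", " y "⟫" => @inner ℝ _ _ x y

/-- The derivative of a function along a line, in terms of its gradient. -/
theorem HasGradientAt.hasDerivAt_comp_add_smul {E : Type*} [NormedAddCommGroup E]
    [InnerProductSpace ℝ E] [CompleteSpace E] {f : E → ℝ} {v x d : E} {t : ℝ}
    (h : HasGradientAt f v (x + t • d)) :
    HasDerivAt (fun s : ℝ => f (x + s • d)) ⟪v, d⟫ t := by
  have hline : HasDerivAt (fun s : ℝ => x + s • d) d t := by
    simpa using ((hasDerivAt_id t).smul_const d).const_add x
  simpa [Function.comp_def] using h.hasFDerivAt.comp_hasDerivAt t hline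

/-- First-order characterization of strong convexity. -/
theorem ConvexOn.add_inner_gradient_add_sq_le {E : Type*} [NormedAddCommGroup E]
    [InnerProductSpace ℝ E] [CompleteSpace E] {f : E → ℝ} {v x : E} {m : ℝ}
    (hf : ConvexOn ℝ Set.univ (fun z => f z - m / 2 * ‖z‖ ^ 2))
    (hx : HasGradientAt f v x) (y : E) :
    f x + ⟪v, y - x⟫ + m / 2 * ‖y - x‖ ^ 2 ≤ f y := by
  have hconv : ConvexOn ℝ Set.univ
      (fun t : ℝ => f (x + t • (y - x)) - m / 2 * ‖x + t • (y - x)‖ ^ 2) := by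
    have h := hf.comp_affineMap (AffineMap.lineMap x y : ℝ →ᵃ[ℝ] E)
    simpa [Function.comp_def, AffineMap.lineMap_apply, add_comm] using h
  have hline : HasDerivAt (fun s : ℝ => x + s • (y - x)) (y - x) 0 := by
    simpa using ((hasDerivAt_id (0 : ℝ)).smul_const (y - x)).const_add x
  have hd : HasDerivAt
      (fun t : ℝ => f (x + t • (y - x)) - m / 2 * ‖x + t • (y - x)‖ ^ 2)
      (⟪v, y - x⟫ - m / 2 * (2 * ⟪x, y - x⟫)) 0 := by
    refine HasDerivAt.sub (HasGradientAt.hasDerivAt_comp_add_smul (by simpa using hx)) ?_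
    simpa using hline.norm_sq.const_mul (m / 2)
  have h := hconv.le_slope_of_hasDerivAt (Set.mem_univ 0) (Set.mem_univ 1) one_pos hd
  have hy : ‖y‖ ^ 2 = ‖x‖ ^ 2 + 2 * ⟪x, y - x⟫ + ‖y - x‖ ^ 2 := by
    rw [← norm_add_sq_real, add_sub_cancel]
  simp [slope_def_field] at h
  rw [hy] at h
  linarith

/-- The descent lemma for functions with Lipschitz gradient. -/
theorem le_add_inner_gradient_add_sq {E : Type*} [NormedAddCommGroup E]
    [InnerProductSpace ℝ E] [CompleteSpace E] {f : E → ℝ} {g : E → E} {L : ℝ}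
    (hg : ∀ z, HasGradientAt f (g z) z) (hlip : ∀ z w, ‖g z - g w‖ ≤ L * ‖z - w‖) (x y : E) :
    f y ≤ f x + ⟪g x, y - x⟫ + L / 2 * ‖y - x‖ ^ 2 := by
  set d := y - x with hd
  have hB : ∀ t : ℝ, HasDerivAt
      (fun s : ℝ => f x + s * ⟪g x, d⟫ + s ^ 2 * (L / 2 * ‖d‖ ^ 2))
      (⟪g x, d⟫ + 2 * t * (L / 2 * ‖d‖ ^ 2)) t := fun t => by
    refine HasDerivAt.add ?_ ?_
    · simpa using ((hasDerivAt_id t).mul_const ⟪g x, d⟫).const_add (f x)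
    · simpa using ((hasDerivAt_id t).pow 2).mul_const (L / 2 * ‖d‖ ^ 2)
  have hA : ∀ t : ℝ, HasDerivAt (fun s : ℝ => f (x + s • d)) ⟪g (x + t • d), d⟫ t :=
    fun t => (hg _).hasDerivAt_comp_add_smul
  have h := image_le_of_deriv_right_le_deriv_boundary (a := 0) (b := 1)
    (fun t _ => (hA t).continuousAt.continuousWithinAt) (fun t _ => (hA t).hasDerivWithinAt)
    (by simp) (fun t _ => (hB t).continuousAt.continuousWithinAt)
    (fun t _ => (hB t).hasDerivWithinAt) ?_ (Set.right_mem_Icc.2 zero_le_one)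
  · simpa [hd] using h
  · intro t ht
    have h1 : ⟪g (x + t • d) - g x, d⟫ ≤ L * (t * ‖d‖) * ‖d‖ := by
      refine (real_inner_le_norm _ _).trans (mul_le_mul_of_nonneg_right ?_ (norm_nonneg _))
      simpa [norm_smul, abs_of_nonneg ht.1] using hlip (x + t • d) x
    rw [inner_sub_left] at h1
    linarith

/-- The gradient of a strongly convex function is strongly monotone. -/
theorem ConvexOn.mul_sq_le_inner_gradient_sub {E : Type*} [NormedAddCommGroup E]
    [InnerProductSpace ℝ E] [CompleteSpace E] {f : E → ℝ} {u v x y : E} {m : ℝ}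
    (hf : ConvexOn ℝ Set.univ (fun z => f z - m / 2 * ‖z‖ ^ 2))
    (hx : HasGradientAt f u x) (hy : HasGradientAt f v y) :
    m * ‖x - y‖ ^ 2 ≤ ⟪u - v, x - y⟫ := by
  have h1 := hf.add_inner_gradient_add_sq_le hx y
  have h2 := hf.add_inner_gradient_add_sq_le hy x
  rw [← neg_sub x y, inner_neg_right, norm_neg] at h1
  rw [inner_sub_left]
  linarith

/-- The Baillon–Haddad theorem: a Lipschitz gradient of a convex function is cocoercive. -/
theorem norm_gradient_sub_sq_le_mul_inner {E : Type*} [NormedAddCommGroup E]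
    [InnerProductSpace ℝ E] [CompleteSpace E] {f : E → ℝ} {g : E → E} {L : ℝ} (hL : 0 < L)
    (hconv : ∀ x y, f x + ⟪g x, y - x⟫ ≤ f y) (hg : ∀ z, HasGradientAt f (g z) z)
    (hlip : ∀ z w, ‖g z - g w‖ ≤ L * ‖z - w‖) (x y : E) :
    ‖g x - g y‖ ^ 2 ≤ L * ⟪g x - g y, x - y⟫ := by
  have key : ∀ x y, f x + ⟪g x, y - x⟫ + L⁻¹ / 2 * ‖g y - g x‖ ^ 2 ≤ f y := fun x y => by
    have h1 := hconv x (y - L⁻¹ • (g y - g x))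
    have h2 := le_add_inner_gradient_add_sq hg hlip y (y - L⁻¹ • (g y - g x))
    have e1 : y - L⁻¹ • (g y - g x) - x = (y - x) - L⁻¹ • (g y - g x) := by abel
    have e2 : y - L⁻¹ • (g y - g x) - y = -(L⁻¹ • (g y - g x)) := by abel
    have e3 : ⟪g y, g y - g x⟫ - ⟪g x, g y - g x⟫ = ‖g y - g x‖ ^ 2 := by
      rw [← inner_sub_left, real_inner_self_eq_norm_sq]
    have e4 : L / 2 * (L⁻¹ * ‖g y - g x‖) ^ 2 = L⁻¹ / 2 * ‖g y - g x‖ ^ 2 := by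
      field_simp
    rw [e1, inner_sub_right, inner_smul_right] at h1
    rw [e2, inner_neg_right, inner_smul_right, norm_neg, norm_smul, Real.norm_eq_abs,
      abs_of_pos (inv_pos.2 hL), e4] at h2
    have e5 := congrArg (L⁻¹ * ·) e3
    simp only [mul_sub] at e5
    linarith
  have h1 := key x y
  have h2 := key y x
  rw [← neg_sub x y, inner_neg_right, norm_sub_rev] at h1
  have h3 : L⁻¹ * ‖g x - g y‖ ^ 2 ≤ ⟪g x - g y, x - y⟫ := by
    rw [inner_sub_left]
    linarith
  rwa [inv_mul_le_iff₀ hL] at h3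

/-- A gradient step on a strongly convex function with Lipschitz gradient is Lipschitz. -/
theorem ConvexOn.norm_gradient_step_sub_le {E : Type*} [NormedAddCommGroup E]
    [InnerProductSpace ℝ E] [CompleteSpace E] {f : E → ℝ} {g : E → E} {L γ m : ℝ}
    (hL : 0 < L) (hm : 0 ≤ m) (hγ0 : 0 ≤ γ) (hγ : γ ≤ 2 / L)
    (hf : ConvexOn ℝ Set.univ (fun z => f z - m / 2 * ‖z‖ ^ 2))
    (hg : ∀ z, HasGradientAt f (g z) z) (hlip : ∀ z w, ‖g z - g w‖ ≤ L * ‖z - w‖) (x y : E) :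
    ‖(x - γ • g x) - (y - γ • g y)‖ ≤
      Real.sqrt (1 - 2 * γ * m + γ ^ 2 * m * L) * ‖x - y‖ := by
  have hconv : ∀ x y, f x + ⟪g x, y - x⟫ ≤ f y := fun x y => by
    have h1 := hf.add_inner_gradient_add_sq_le (hg x) y
    have h2 : 0 ≤ m / 2 * ‖y - x‖ ^ 2 := by positivity
    linarith
  have hco := norm_gradient_sub_sq_le_mul_inner hL hconv hg hlip x y
  have hmono := hf.mul_sq_le_inner_gradient_sub (hg x) (hg y)
  have hstep : 0 ≤ γ * (2 - γ * L) :=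
    mul_nonneg hγ0 (sub_nonneg.2 ((le_div_iff₀ hL).1 hγ))
  have hsq : ‖(x - γ • g x) - (y - γ • g y)‖ ^ 2 ≤
      (1 - 2 * γ * m + γ ^ 2 * m * L) * ‖x - y‖ ^ 2 := by
    have e : (x - γ • g x) - (y - γ • g y) = (x - y) - γ • (g x - g y) := by
      rw [smul_sub]; abel
    rw [e, norm_sub_sq_real, inner_smul_right, norm_smul, mul_pow, Real.norm_eq_abs, sq_abs,
      real_inner_comm]
    nlinarith [mul_le_mul_of_nonneg_left hco (sq_nonneg γ),
      mul_le_mul_of_nonneg_left hmono hstep]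
  calc _ ≤ Real.sqrt ((1 - 2 * γ * m + γ ^ 2 * m * L) * ‖x - y‖ ^ 2) := Real.le_sqrt_of_sq_le hsq
    _ = _ := by rw [Real.sqrt_mul' _ (sq_nonneg _), Real.sqrt_sq (norm_nonneg _)]

/-- If `‖u i‖ ≤ q * ‖d i‖`, then averaging `u` and pairing with `d` costs at most `q * ∑ ‖d i‖ ^ 2`. -/
theorem sum_inner_average_le {E ι : Type*} [NormedAddCommGroup E] [InnerProductSpace ℝ E]
    [Fintype ι] {q : ℝ} (hq : 0 ≤ q) {u d : ι → E} (h : ∀ i, ‖u i‖ ≤ q * ‖d i‖) :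
    ∑ i, ⟪(Fintype.card ι : ℝ)⁻¹ • ∑ l, u l, d i⟫ ≤ q * ∑ i, ‖d i‖ ^ 2 := by
  have hu : ‖∑ l, u l‖ ≤ q * ∑ l, ‖d l‖ := by
    rw [Finset.mul_sum]
    exact norm_sum_le_of_le _ fun i _ => h i
  have hs : (∑ i, ‖d i‖) ^ 2 ≤ Fintype.card ι * ∑ i, ‖d i‖ ^ 2 := sq_sum_le_card_mul_sum_sq
  rw [← inner_sum, real_inner_smul_left]
  calc _ ≤ (Fintype.card ι : ℝ)⁻¹ * ((q * ∑ l, ‖d l‖) * ∑ l, ‖d l‖) := by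
        gcongr
        exact (real_inner_le_norm _ _).trans
          (mul_le_mul hu (norm_sum_le _ _) (norm_nonneg _) (by positivity))
    _ = q * ((Fintype.card ι : ℝ)⁻¹ * (∑ l, ‖d l‖) ^ 2) := by ring
    _ ≤ q * ∑ i, ‖d i‖ ^ 2 := by
        gcongr
        exact inv_mul_le_of_le_mul₀ (by positivity) (by positivity) hs

/-- Finito operator strong quasi-monotonicity: if each `f_i` is `μ̂`-strongly convex
with `L`-Lipschitz gradient, `0 < μ̂ ≤ L` and `0 < γ ≤ 2/L`, then the Finito operator
`S(x) = x − P_D(x₁ − γ∇f₁(x₁), …, x_N − γ∇f_N(x_N))` satisfies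
`⟪S x − S y, x − y⟫ ≥ (1 − √(1 − 2γμ̂ + γ²μ̂L))‖x − y‖²`. -/
theorem finito_strongly_monotone
    {H0 : Type*} [NormedAddCommGroup H0] [InnerProductSpace ℝ H0] [CompleteSpace H0]
    (N : ℕ) (hN : 0 < N) (L γ μhat : ℝ) (hL : 0 < L)
    (hμ0 : 0 < μhat) (hμL : μhat ≤ L) (hγ0 : 0 < γ) (hγ : γ ≤ 2 / L)
    (f : Fin N → H0 → ℝ) (g : Fin N → H0 → H0)
    (hsconv : ∀ i, ConvexOn ℝ Set.univ (fun z => f i z - μhat / 2 * ‖z‖ ^ 2))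
    (hgrad : ∀ i z, HasGradientAt (f i) (g i z) z)
    (hlip : ∀ i, ∀ z w : H0, ‖g i z - g i w‖ ≤ L * ‖z - w‖)
    (S : PiLp 2 (fun _ : Fin N => H0) → PiLp 2 (fun _ : Fin N => H0))
    (hS : ∀ (x : PiLp 2 (fun _ : Fin N => H0)) (i : Fin N),
      WithLp.equiv 2 (Fin N → H0) (S x) i =
        WithLp.equiv 2 (Fin N → H0) x i -
          (N : ℝ)⁻¹ • ∑ l, (WithLp.equiv 2 (Fin N → H0) x l -
            γ • g l (WithLp.equiv 2 (Fin N → H0) x l))) :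
    ∀ x y : PiLp 2 (fun _ : Fin N => H0),
      (1 - Real.sqrt (1 - 2 * γ * μhat + γ ^ 2 * μhat * L)) * ‖x - y‖ ^ 2 ≤
        ⟪S x - S y, x - y⟫ := by
  intro x y
  have hS' : ∀ (x : PiLp 2 (fun _ : Fin N => H0)) (i : Fin N),
      S x i = x i - (N : ℝ)⁻¹ • ∑ l, (x l - γ • g l (x l)) := hS
  have key := sum_inner_average_le
    (u := fun l => (x l - γ • g l (x l)) - (y l - γ • g l (y l))) (d := fun l => x l - y l)
    (Real.sqrt_nonneg (1 - 2 * γ * μhat + γ ^ 2 * μhat * L))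
    fun i => (hsconv i).norm_gradient_step_sub_le hL hμ0.le hγ0.le hγ (hgrad i) (hlip i) _ _
  have hinner : ⟪S x - S y, x - y⟫ = ‖x - y‖ ^ 2 - ∑ i, ⟪(Fintype.card (Fin N) : ℝ)⁻¹ •
      ∑ l, ((x l - γ • g l (x l)) - (y l - γ • g l (y l))), x i - y i⟫ := by
    rw [PiLp.inner_apply, PiLp.norm_sq_eq_of_L2, ← Finset.sum_sub_distrib]
    refine Finset.sum_congr rfl fun i _ => ?_
    rw [PiLp.sub_apply, PiLp.sub_apply, hS', hS', Fintype.card_fin,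
      Finset.sum_sub_distrib (fun l => x l - γ • g l (x l)) (fun l => y l - γ • g l (y l)), smul_sub, ← real_inner_self_eq_norm_sq, ← inner_sub_left]
    congr 1
    abel
  have hnorm : ‖x - y‖ ^ 2 = ∑ i, ‖x i - y i‖ ^ 2 := PiLp.norm_sq_eq_of_L2 _ _
  rw [hinner, sub_mul, one_mul]
  rw [← hnorm] at key
  linarith
end

section
/- Proximal SAGA operator coherence (Proposition C.6, Part 1): let g : H → ℝ be convex, let γ > 0, and let p : H → H satisfy the proximal law for γg: for every x, z ∈ H, g(z) ≥ g(p(x)) + ⟨(x − p(x))/γ, z − p(x)⟩. Let f_1, …, f_N : H → ℝ be convex differentiable with L-Lipschitz gradients. Define S_i := (γ/N)·∇f_i ∘ p for i = 1, …, N, S_{N+1} := I − p, and S := (1/(N+1))Σ_{i=1}^{N+1} S_i. Then for every x ∈ H and every x* ∈ H with S(x*) = 0, ⟨S(x), x − x*⟩ ≥ (N/(2γL(N+1)))·Σ_{i=1}^N ‖S_i(x) − S_i(x*)‖² + (1/(N+1))(1 − γL/2)‖S_{N+1}(x) − S_{N+1}(x*)‖². -/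
local notation "⟪" x ", " y "⟫" => @inner ℝ _ _ x y

section Gradient

variable {H : Type*} [NormedAddCommGroup H] [InnerProductSpace ℝ H] [CompleteSpace H]

/-- The derivative of a differentiable function along a line. -/
theorem HasGradientAt.hasDerivAt_comp_line {f : H → ℝ} {f' x v : H} {t : ℝ}
    (h : HasGradientAt f f' (x + t • v)) :
    HasDerivAt (fun s : ℝ => f (x + s • v)) (inner ℝ f' v) t := by
  have hline : HasDerivAt (fun s : ℝ => x + s • v) v t := by
    simpa using ((hasDerivAt_id t).smul_const v).const_add x
  simpa [Function.comp_def] using h.hasFDerivAt.comp_hasDerivAt t hline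

/-- A convex function lies above its tangent hyperplanes. -/
theorem ConvexOn.add_inner_le_of_hasGradientAt {f : H → ℝ} {f' x : H}
    (hf : ConvexOn ℝ Set.univ f) (h : HasGradientAt f f' x) (y : H) :
    f x + inner ℝ f' (y - x) ≤ f y := by
  have hline : ConvexOn ℝ Set.univ (fun t : ℝ => f (x + t • (y - x))) := by
    have := hf.comp_affineMap (AffineMap.lineMap x y : ℝ →ᵃ[ℝ] H)
    simpa [Function.comp_def, AffineMap.lineMap_apply, add_comm] using this
  have hderiv : HasDerivAt (fun t : ℝ => f (x + t • (y - x))) (inner ℝ f' (y - x)) 0 :=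
    HasGradientAt.hasDerivAt_comp_line (by simpa using h)
  have := hline.le_slope_of_hasDerivAt (Set.mem_univ 0) (Set.mem_univ 1) one_pos hderiv
  simp only [slope_def_field, one_smul, zero_smul, add_zero, add_sub_cancel, sub_zero, div_one]
    at this
  linarith

/-- The quadratic upper bound (descent lemma) for functions with Lipschitz gradient. -/
theorem le_add_inner_add_of_lipschitz_gradient {f : H → ℝ} {f' : H → H} {L : ℝ}
    (h : ∀ x, HasGradientAt f (f' x) x) (hlip : ∀ x y, ‖f' x - f' y‖ ≤ L * ‖x - y‖) (x y : H) :
    f y ≤ f x + inner ℝ (f' x) (y - x) + L / 2 * ‖y - x‖ ^ 2 := by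
  set v := y - x with hv
  have hderiv (t : ℝ) : HasDerivAt
      (fun s : ℝ => f (x + s • v) - s * inner ℝ (f' x) v - L / 2 * ‖v‖ ^ 2 * s ^ 2)
      (inner ℝ (f' (x + t • v)) v - inner ℝ (f' x) v - L * ‖v‖ ^ 2 * t) t := by
    have h1 := (h (x + t • v)).hasDerivAt_comp_line
    have h2 := (hasDerivAt_id t).mul_const (inner ℝ (f' x) v)
    have h3 := (hasDerivAt_pow 2 t).const_mul (L / 2 * ‖v‖ ^ 2)
    refine ((h1.sub h2).sub h3).congr_deriv ?_
    push_cast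
    ring
  have hanti : AntitoneOn
      (fun s : ℝ => f (x + s • v) - s * inner ℝ (f' x) v - L / 2 * ‖v‖ ^ 2 * s ^ 2)
      (Set.Ici 0) := by
    refine antitoneOn_of_deriv_nonpos (convex_Ici 0)
      (fun t _ => (hderiv t).continuousAt.continuousWithinAt)
      (fun t _ => (hderiv t).differentiableAt.differentiableWithinAt) fun t ht => ?_
    rw [interior_Ici, Set.mem_Ioi] at ht
    rw [(hderiv t).deriv, ← inner_sub_left]
    have h1 := real_inner_le_norm (f' (x + t • v) - f' x) v
    have h2 := hlip (x + t • v) x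
    rw [add_sub_cancel_left, norm_smul, Real.norm_of_nonneg ht.le] at h2
    have h3 := mul_le_mul_of_nonneg_right h2 (norm_nonneg v)
    linarith
  have := hanti (Set.mem_Ici.2 le_rfl) (Set.mem_Ici.2 zero_le_one) zero_le_one
  have hxv : x + v = y := by simp [hv]
  simp only [one_smul, zero_smul, hxv, add_zero] at this
  linarith

/-- The tangent inequality strengthened by the gradient gap, for convex functions with Lipschitz
gradient. -/
theorem ConvexOn.add_inner_add_le_of_lipschitz_gradient {f : H → ℝ} {f' : H → H} {L : ℝ}
    (hL : 0 < L) (hf : ConvexOn ℝ Set.univ f) (h : ∀ x, HasGradientAt f (f' x) x)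
    (hlip : ∀ x y, ‖f' x - f' y‖ ≤ L * ‖x - y‖) (x y : H) :
    f x + inner ℝ (f' x) (y - x) + 1 / (2 * L) * ‖f' y - f' x‖ ^ 2 ≤ f y := by
  set w := f' y - f' x with hw
  have h1 := hf.add_inner_le_of_hasGradientAt (h x) (y - L⁻¹ • w)
  have h2 := le_add_inner_add_of_lipschitz_gradient h hlip y (y - L⁻¹ • w)
  have hz : y - L⁻¹ • w - x = (y - x) - L⁻¹ • w := by abel
  have hz' : y - L⁻¹ • w - y = -(L⁻¹ • w) := by abel
  rw [hz, inner_sub_right, real_inner_smul_right] at h1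
  rw [hz', inner_neg_right, real_inner_smul_right, norm_neg, norm_smul, mul_pow,
    Real.norm_of_nonneg (inv_nonneg.2 hL.le)] at h2
  have h3 : inner ℝ (f' y) w - inner ℝ (f' x) w = ‖w‖ ^ 2 := by
    rw [← inner_sub_left, real_inner_self_eq_norm_sq]
  have h4 : L⁻¹ * inner ℝ (f' y) w = L⁻¹ * inner ℝ (f' x) w + L⁻¹ * ‖w‖ ^ 2 := by
    rw [← h3]; ring
  have h5 : L / 2 * (L⁻¹ ^ 2 * ‖w‖ ^ 2) = L⁻¹ * ‖w‖ ^ 2 / 2 := by field_simp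
  have h6 : 1 / (2 * L) * ‖w‖ ^ 2 = L⁻¹ * ‖w‖ ^ 2 / 2 := by field_simp
  linarith

/-- The Baillon–Haddad theorem: an `L`-Lipschitz gradient of a convex function is
`1 / L`-cocoercive. -/
theorem ConvexOn.norm_sq_gradient_sub_le_inner {f : H → ℝ} {f' : H → H} {L : ℝ}
    (hL : 0 < L) (hf : ConvexOn ℝ Set.univ f) (h : ∀ x, HasGradientAt f (f' x) x)
    (hlip : ∀ x y, ‖f' x - f' y‖ ≤ L * ‖x - y‖) (x y : H) :
    1 / L * ‖f' x - f' y‖ ^ 2 ≤ inner ℝ (f' x - f' y) (x - y) := by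
  have h1 := hf.add_inner_add_le_of_lipschitz_gradient hL h hlip x y
  have h2 := hf.add_inner_add_le_of_lipschitz_gradient hL h hlip y x
  rw [norm_sub_rev, ← neg_sub x y, inner_neg_right] at h1
  rw [inner_sub_left]
  have h3 : 1 / L * ‖f' x - f' y‖ ^ 2 = 2 * (1 / (2 * L) * ‖f' x - f' y‖ ^ 2) := by field_simp
  linarith

end Gradient

/-- A map satisfying the proximal subgradient law is firmly nonexpansive. -/
theorem inner_sub_prox_nonneg {H : Type*} [NormedAddCommGroup H] [InnerProductSpace ℝ H]
    {γ : ℝ} (hγ : 0 < γ) {g : H → ℝ} {p : H → H}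
    (hprox : ∀ x z : H, g (p x) + (1 / γ) * inner ℝ (x - p x) (z - p x) ≤ g z) (x y : H) :
    0 ≤ inner ℝ ((x - p x) - (y - p y)) (p x - p y) := by
  have h1 := hprox x (p y)
  have h2 := hprox y (p x)
  rw [← neg_sub (p x) (p y), inner_neg_right] at h1
  refine nonneg_of_mul_nonneg_right (a := 1 / γ) ?_ (by positivity)
  rw [inner_sub_left, mul_sub]
  linarith

/-- Young's inequality for the inner product. -/
theorem neg_le_real_inner_young {H : Type*} [NormedAddCommGroup H] [InnerProductSpace ℝ H]
    {c : ℝ} (hc : 0 < c) (u v : H) :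
    -(c / 2 * ‖u‖ ^ 2 + 1 / (2 * c) * ‖v‖ ^ 2) ≤ inner ℝ u v := by
  have h1 := neg_le_of_abs_le (abs_real_inner_le_norm u v)
  have h2 : c / 2 * ‖u‖ ^ 2 + 1 / (2 * c) * ‖v‖ ^ 2 - ‖u‖ * ‖v‖
      = 1 / (2 * c) * (c * ‖u‖ - ‖v‖) ^ 2 := by field_simp; ring
  have h3 : 0 ≤ 1 / (2 * c) * (c * ‖u‖ - ‖v‖) ^ 2 := by positivity
  linarith

/-- Proximal SAGA operator coherence: with `S_i = (γ/N)∇f_i ∘ prox_{γg}` for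
`i = 1, …, N`, `S_{N+1} = I − prox_{γg}`, and `S = (1/(N+1)) Σ S_i`, the coherence
inequality holds with the stated constants. -/
theorem prox_saga_coherence
    {H : Type*} [NormedAddCommGroup H] [InnerProductSpace ℝ H] [CompleteSpace H]
    (N : ℕ) (hN : 0 < N) (L γ : ℝ) (hL : 0 < L) (hγ : 0 < γ)
    (g : H → ℝ) (hg : ConvexOn ℝ Set.univ g)
    (p : H → H)
    (hprox : ∀ x z : H, g (p x) + (1 / γ) * ⟪x - p x, z - p x⟫ ≤ g z)
    (f : Fin N → H → ℝ) (gradf : Fin N → H → H)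
    (hconv : ∀ i, ConvexOn ℝ Set.univ (f i))
    (hgrad : ∀ i x, HasGradientAt (f i) (gradf i x) x)
    (hlip : ∀ i, ∀ x y : H, ‖gradf i x - gradf i y‖ ≤ L * ‖x - y‖)
    (S : H → H)
    (hS : ∀ x, S x = ((N : ℝ) + 1)⁻¹ •
      ((∑ i, (γ / (N : ℝ)) • gradf i (p x)) + (x - p x))) :
    ∀ x xs : H, S xs = 0 →
      ((N : ℝ) / (2 * γ * L * ((N : ℝ) + 1))) *
          (∑ i, ‖(γ / (N : ℝ)) • gradf i (p x) - (γ / (N : ℝ)) • gradf i (p xs)‖ ^ 2) +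
        ((N : ℝ) + 1)⁻¹ * (1 - γ * L / 2) * ‖(x - p x) - (xs - p xs)‖ ^ 2 ≤
        ⟪S x, x - xs⟫ := by
  intro x xs hxs
  have hN' : (0 : ℝ) < N := Nat.cast_pos.2 hN
  set r := (x - p x) - (xs - p xs) with hr
  set s : Fin N → H := fun i =>
    (γ / (N : ℝ)) • gradf i (p x) - (γ / (N : ℝ)) • gradf i (p xs) with hs
  have hSx : S x = ((N : ℝ) + 1)⁻¹ • ((∑ i, s i) + r) := by
    rw [← sub_zero (S x), ← hxs, hS x, hS xs, ← smul_sub, hs, hr, Finset.sum_sub_distrib]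
    congr 1
    abel
  have hcoer (i : Fin N) : N / (γ * L) * ‖s i‖ ^ 2 ≤ inner ℝ (s i) (p x - p xs) := by
    have h := mul_le_mul_of_nonneg_left
      ((hconv i).norm_sq_gradient_sub_le_inner hL (hgrad i) (hlip i) (p x) (p xs))
      (div_pos hγ hN').le
    simp only [hs, ← smul_sub, real_inner_smul_left, norm_smul, mul_pow,
      Real.norm_of_nonneg (div_pos hγ hN').le]
    refine le_trans (le_of_eq ?_) h
    field_simp
  have hsum : N / (2 * γ * L) * ∑ i, ‖s i‖ ^ 2 - γ * L / 2 * ‖r‖ ^ 2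
      ≤ inner ℝ (∑ i, s i) ((p x - p xs) + r) := by
    have hi (i : Fin N) : N / (2 * γ * L) * ‖s i‖ ^ 2 - γ * L / (2 * N) * ‖r‖ ^ 2
        ≤ inner ℝ (s i) ((p x - p xs) + r) := by
      have hy := neg_le_real_inner_young (c := N / (γ * L)) (by positivity) (s i) r
      have h1 : 1 / (2 * (N / (γ * L))) = γ * L / (2 * N) := by field_simp
      have h2 : N / (2 * γ * L) * ‖s i‖ ^ 2 = N / (γ * L) / 2 * ‖s i‖ ^ 2 := by
        field_simp
      rw [h1] at hy
      rw [inner_add_right]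
      linarith [hcoer i]
    rw [sum_inner]
    refine le_trans (le_of_eq ?_) (Finset.sum_le_sum fun i _ => hi i)
    rw [Finset.sum_sub_distrib, ← Finset.mul_sum, Finset.sum_const, Finset.card_univ,
      Fintype.card_fin, nsmul_eq_mul]
    field_simp
  have hmono : ‖r‖ ^ 2 ≤ inner ℝ r ((p x - p xs) + r) := by
    rw [inner_add_right, real_inner_self_eq_norm_sq]
    linarith [inner_sub_prox_nonneg hγ hprox x xs]
  have hx : x - xs = (p x - p xs) + r := by rw [hr]; abel
  rw [hSx, real_inner_smul_left, hx, inner_add_left]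
  have hfactor : (N : ℝ) / (2 * γ * L * (N + 1)) * (∑ i, ‖s i‖ ^ 2)
      + ((N : ℝ) + 1)⁻¹ * (1 - γ * L / 2) * ‖r‖ ^ 2
      = ((N : ℝ) + 1)⁻¹ * (N / (2 * γ * L) * (∑ i, ‖s i‖ ^ 2) - γ * L / 2 * ‖r‖ ^ 2
        + ‖r‖ ^ 2) := by
    field_simp
    ring
  refine hfactor.le.trans (mul_le_mul_of_nonneg_left (add_le_add hsum hmono) (by positivity))
end
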